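/- arXiv:2209.14119 — 3 statements merged into one kernel-verified Lean document; each statement's English description precedes it below -/
import Mathlib

section
/- Let ℓ : ℝ × ℝ → ℝ be positively homogeneous of degree one, with ℓ(s) > 0 for every s ≠ (0,0). Suppose that at every point (x,y) ≠ (0,0) the two coordinatewise partial derivatives of ℓ exist and satisfy ∂ℓ/∂x(x,y) = x/ℓ(x,y) and ∂ℓ/∂y(x,y) = y/ℓ(x,y). Then ℓ(x,y) = √(x² + y²) for every (x,y) ∈ ℝ × ℝ. -/
/-- If `f` is nonzero with derivative `t / f t` everywhere, then `f ^ 2 - t ^ 2` is constant. -/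
theorem sq_sub_sq_eq_of_hasDerivAt_div {f : ℝ → ℝ} (hf : ∀ t, f t ≠ 0)
    (hd : ∀ t, HasDerivAt f (t / f t) t) (a b : ℝ) :
    f a ^ 2 - a ^ 2 = f b ^ 2 - b ^ 2 := by
  have h : ∀ t, HasDerivAt (fun t => f t ^ 2 - t ^ 2) 0 t := fun t => by
    refine (((hd t).fun_pow 2).fun_sub ((hasDerivAt_id' t).fun_pow 2)).congr_deriv ?_
    simp [mul_assoc, mul_div_cancel₀ t (hf t)]
  exact is_const_of_deriv_eq_zero (fun t => (h t).differentiableAt) (fun t => (h t).deriv) a b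

theorem pythagorean_from_partials
    (ℓ : ℝ × ℝ → ℝ)
    (hhom : ∀ (α : ℝ), 0 < α → ∀ s : ℝ × ℝ, ℓ (α • s) = α * ℓ s)
    (hpos : ∀ s : ℝ × ℝ, s ≠ 0 → 0 < ℓ s)
    (hderiv : ∀ x y : ℝ, (x, y) ≠ (0, 0) →
      HasDerivAt (fun t => ℓ (t, y)) (x / ℓ (x, y)) x ∧
      HasDerivAt (fun t => ℓ (x, t)) (y / ℓ (x, y)) y) :
    ∀ x y : ℝ, ℓ (x, y) = Real.sqrt (x ^ 2 + y ^ 2) := by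
  have horiz : ∀ y : ℝ, y ≠ 0 → ∀ a b : ℝ,
      ℓ (a, y) ^ 2 - a ^ 2 = ℓ (b, y) ^ 2 - b ^ 2 := fun y hy =>
    sq_sub_sq_eq_of_hasDerivAt_div (f := fun t => ℓ (t, y))
      (fun t => (hpos (t, y) (by simp [hy])).ne') (fun t => (hderiv t y (by simp [hy])).1)
  have vert : ∀ x : ℝ, x ≠ 0 → ∀ a b : ℝ,
      ℓ (x, a) ^ 2 - a ^ 2 = ℓ (x, b) ^ 2 - b ^ 2 := fun x hx =>
    sq_sub_sq_eq_of_hasDerivAt_div (f := fun t => ℓ (x, t))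
      (fun t => (hpos (x, t) (by simp [hx])).ne') (fun t => (hderiv x t (by simp [hx])).2)
  have hone : ℓ (1, 1) ^ 2 = 2 := by
    have h2 : ℓ (2, 2) = 2 * ℓ (1, 1) := by simpa using hhom 2 two_pos (1, 1)
    have h3 := horiz 2 two_ne_zero 2 1
    have h4 := vert 1 one_ne_zero 2 1
    rw [h2] at h3
    linarith
  have hsq : ∀ x y : ℝ, (x, y) ≠ 0 → ℓ (x, y) ^ 2 = x ^ 2 + y ^ 2 := by
    intro x y hxy
    by_cases hy : y = 0
    · have hx : x ≠ 0 := by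
        rintro rfl
        exact hxy (by simp [hy])
      linarith [vert x hx y 1, horiz 1 one_ne_zero x 1]
    · linarith [horiz y hy x 1, vert 1 one_ne_zero y 1]
  intro x y
  by_cases hxy : (x, y) = (0 : ℝ × ℝ)
  · have h0 : ℓ 0 = 2 * ℓ 0 := by simpa using hhom 2 two_pos 0
    obtain ⟨rfl, rfl⟩ := Prod.mk_eq_zero.mp hxy
    rw [hxy]
    simp
    linarith
  · rw [← hsq x y hxy, Real.sqrt_sq (hpos _ hxy).le]
end

section
/- Let n ≥ 1 and let ℓ : EuclideanSpace ℝ (Fin n) → ℝ be positively homogeneous of degree one, with ℓ(s) > 0 for every s ≠ 0. Suppose that at every s ≠ 0 the function ℓ has a gradient ∇ℓ(s) satisfying s = ℓ(s) • ∇ℓ(s). Then ℓ(s) = ‖s‖ (the Euclidean norm) for every s. -/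
/-- Euler's identity for positively homogeneous functions of degree one. -/
theorem HasGradientAt.inner_eq_of_posHomogeneous {E : Type*} [NormedAddCommGroup E]
    [InnerProductSpace ℝ E] [CompleteSpace E] {f : E → ℝ} {v s : E}
    (hf : HasGradientAt f v s) (hhom : ∀ α : ℝ, 0 < α → f (α • s) = α * f s) :
    inner ℝ v s = f s := by
  have hline : HasDerivAt (fun t : ℝ => t • s) s 1 := by
    simpa using (hasDerivAt_id (1 : ℝ)).smul_const s
  have hfd : HasFDerivAt f (InnerProductSpace.toDual ℝ E v) ((1 : ℝ) • s) := by
    rw [one_smul]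
    exact hf.hasFDerivAt
  have hcomp : HasDerivAt (fun t : ℝ => f (t • s)) (inner ℝ v s) 1 := by
    simpa [Function.comp_def] using hfd.comp_hasDerivAt (1 : ℝ) hline
  have hlin : HasDerivAt (fun t : ℝ => t * f s) (f s) 1 := by
    simpa using (hasDerivAt_id (1 : ℝ)).mul_const (f s)
  refine hcomp.unique (hlin.congr_of_eventuallyEq ?_)
  filter_upwards [lt_mem_nhds (zero_lt_one' ℝ)] with t ht using hhom t ht

theorem euclidean_norm_from_gradient_eq
    (n : ℕ) (hn : 1 ≤ n)
    (ℓ : EuclideanSpace ℝ (Fin n) → ℝ)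
    (g : EuclideanSpace ℝ (Fin n) → EuclideanSpace ℝ (Fin n))
    (hhom : ∀ (α : ℝ), 0 < α → ∀ s, ℓ (α • s) = α * ℓ s)
    (hpos : ∀ s, s ≠ 0 → 0 < ℓ s)
    (hgrad : ∀ s, s ≠ 0 → HasGradientAt ℓ (g s) s)
    (heq : ∀ s, s ≠ 0 → s = ℓ s • g s) :
    ∀ s, ℓ s = ‖s‖ := by
  intro s
  rcases eq_or_ne s 0 with rfl | hs
  · have h := hhom 2 two_pos 0
    rw [smul_zero] at h
    rw [norm_zero]
    linarith
  · have heuler := (hgrad s hs).inner_eq_of_posHomogeneous fun α hα => hhom α hα s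
    have hsq : ‖s‖ ^ 2 = ℓ s ^ 2 := by
      calc ‖s‖ ^ 2 = inner ℝ s s := (real_inner_self_eq_norm_sq s).symm
        _ = inner ℝ (ℓ s • g s) s := by rw [← heq s hs]
        _ = ℓ s ^ 2 := by rw [real_inner_smul_left, heuler, sq]
    exact ((sq_eq_sq₀ (norm_nonneg s) (hpos s hs).le).mp hsq).symm
end

section
/- Let n ≥ 1 and let ℓ : EuclideanSpace ℝ (Fin n) → ℝ satisfy ℓ(s) > 0 for every s ≠ 0. Suppose that at every s ≠ 0 the function ℓ has a gradient ∇ℓ(s) satisfying both s = ℓ(s) • ∇ℓ(s) and ℓ(∇ℓ(s)) = 1. Then ℓ(s) = ‖s‖ (the Euclidean norm) for every s ≠ 0. -/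
/-- If `s = ℓ s • ∇ℓ s` away from the origin, then `ℓ ^ 2 - ‖·‖ ^ 2` is constant along each open ray
from the origin. -/
theorem sq_sub_norm_sq_const_on_ray {E : Type*} [NormedAddCommGroup E] [InnerProductSpace ℝ E]
    [CompleteSpace E] {ℓ : E → ℝ} {g : E → E}
    (hgrad : ∀ s, s ≠ 0 → HasGradientAt ℓ (g s) s)
    (heq : ∀ s, s ≠ 0 → s = ℓ s • g s) {s : E} (hs : s ≠ 0) {t : ℝ} (ht : 0 < t) :
    ℓ (t • s) ^ 2 - t ^ 2 * ‖s‖ ^ 2 = ℓ s ^ 2 - ‖s‖ ^ 2 := by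
  have hderiv : ∀ r ∈ Set.Ioi (0 : ℝ),
      HasDerivAt (fun r : ℝ => ℓ (r • s) ^ 2 - r ^ 2 * ‖s‖ ^ 2) 0 r := by
    intro r hr
    have hrs : r • s ≠ 0 := smul_ne_zero (ne_of_gt hr) hs
    have hline : HasDerivAt (fun r : ℝ => r • s) s r := by
      simpa using (hasDerivAt_id r).smul_const s
    have hℓ : HasDerivAt (fun r : ℝ => ℓ (r • s)) (inner ℝ (g (r • s)) s) r := by
      simpa [Function.comp_def] using (hgrad _ hrs).hasFDerivAt.comp_hasDerivAt r hline
    have hinner : ℓ (r • s) * inner ℝ (g (r • s)) s = r * ‖s‖ ^ 2 := by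
      rw [← real_inner_smul_left, ← heq _ hrs, real_inner_smul_left, real_inner_self_eq_norm_sq]
    refine ((hℓ.pow 2).sub ((hasDerivAt_pow 2 r).mul_const (‖s‖ ^ 2))).congr_deriv ?_
    norm_num
    linear_combination 2 * hinner
  have hconst := isOpen_Ioi.is_const_of_deriv_eq_zero isPreconnected_Ioi
    (fun r hr => (hderiv r hr).differentiableAt.differentiableWithinAt)
    (fun r hr => (hderiv r hr).deriv) (Set.mem_Ioi.2 ht) (Set.mem_Ioi.2 one_pos)
  simpa using hconst


theorem euclidean_norm_from_two_equations
    (n : ℕ) (hn : 1 ≤ n)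
    (ℓ : EuclideanSpace ℝ (Fin n) → ℝ)
    (g : EuclideanSpace ℝ (Fin n) → EuclideanSpace ℝ (Fin n))
    (hpos : ∀ s, s ≠ 0 → 0 < ℓ s)
    (hgrad : ∀ s, s ≠ 0 → HasGradientAt ℓ (g s) s)
    (heq1 : ∀ s, s ≠ 0 → s = ℓ s • g s)
    (heq2 : ∀ s, s ≠ 0 → ℓ (g s) = 1) :
    ∀ s, s ≠ 0 → ℓ s = ‖s‖ := by
  intro s hs
  have hray := fun {t : ℝ} (ht : 0 < t) => sq_sub_norm_sq_const_on_ray hgrad heq1 hs ht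
  have hdichotomy : ∀ t : ℝ, 0 < t → (ℓ s ^ 2 - ‖s‖ ^ 2) * (ℓ (t • s) ^ 2 - 1) = 0 := by
    intro t ht
    have hts : t • s ≠ 0 := smul_ne_zero ht.ne' hs
    have hℓ := hpos _ hts
    have hg : g (t • s) = (t / ℓ (t • s)) • s := by
      rw [div_eq_inv_mul, mul_smul, eq_inv_smul_iff₀ hℓ.ne']
      exact (heq1 _ hts).symm
    have hunit := hray (div_pos ht hℓ)
    rw [← hg, heq2 _ hts, div_pow] at hunit
    field_simp at hunit
    linear_combination hray ht - hunit
  have hN : 0 < ‖s‖ ^ 2 := by positivity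
  have hsq : ℓ s ^ 2 = ‖s‖ ^ 2 := by
    by_contra hne
    have h1 := (mul_eq_zero.1 (hdichotomy 1 one_pos)).resolve_left (sub_ne_zero.2 hne)
    have h2 := (mul_eq_zero.1 (hdichotomy 2 two_pos)).resolve_left (sub_ne_zero.2 hne)
    have h3 := hray two_pos
    rw [one_smul] at h1
    linarith
  exact (sq_eq_sq₀ (hpos s hs).le (norm_nonneg s)).1 hsq
end
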